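/- Let E, ρ₀, ρ be d×d complex matrices, let 0 ≤ ε < 1, and suppose ρ̃₀ = (1−ε)·ρ₀ + (ε/d)·I and ρ̃ = (1−ε)·ρ + (ε/d)·I (the same depolarising channel applied to both states). Assume (1/d)·tr(E) ≠ tr(E·ρ₀), and define the estimated rate ε_est = (tr(E·ρ̃₀) − tr(E·ρ₀)) / ((1/d)·tr(E) − tr(E·ρ₀)). Then (1/(1−ε_est))·(tr(E·ρ̃) − (ε_est/d)·tr(E)) = tr(E·ρ); that is, the error-mitigation procedure calibrated on the reference state ρ₀ exactly recovers the noiseless expectation value in the state ρ. -/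

import Mathlib

/-- The error-mitigation procedure calibrated on a reference state `ρ₀` exactly recovers
the noiseless expectation value: with `ρ̃₀` and `ρ̃` the outputs of the same depolarising
channel of rate `ε` applied to `ρ₀` and `ρ`, and
`ε_est = (tr(E·ρ̃₀) − tr(E·ρ₀)) / ((1/d)·tr(E) − tr(E·ρ₀))`, one has
`(1/(1−ε_est))·(tr(E·ρ̃) − (ε_est/d)·tr(E)) = tr(E·ρ)`. -/
theorem depolarising_mitigation_exact (d : ℕ) (E ρ₀ ρ : Matrix (Fin d) (Fin d) ℂ)
    (ε : ℝ) (hε0 : 0 ≤ ε) (hε1 : ε < 1)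
    (ρ₀Noisy ρNoisy : Matrix (Fin d) (Fin d) ℂ)
    (hρ₀ : ρ₀Noisy = ((1 : ℂ) - ε) • ρ₀ + ((ε : ℂ) / d) • (1 : Matrix (Fin d) (Fin d) ℂ))
    (hρ : ρNoisy = ((1 : ℂ) - ε) • ρ + ((ε : ℂ) / d) • (1 : Matrix (Fin d) (Fin d) ℂ))
    (hE : (1 / (d : ℂ)) * E.trace ≠ (E * ρ₀).trace)
    (εEst : ℂ)
    (hεEst : εEst =
      ((E * ρ₀Noisy).trace - (E * ρ₀).trace) / ((1 / (d : ℂ)) * E.trace - (E * ρ₀).trace)) :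
    (1 / ((1 : ℂ) - εEst)) * ((E * ρNoisy).trace - (εEst / d) * E.trace) = (E * ρ).trace := by
  have trace_noisy (σ : Matrix (Fin d) (Fin d) ℂ) :
      (E * (((1 : ℂ) - ε) • σ + ((ε : ℂ) / d) • (1 : Matrix (Fin d) (Fin d) ℂ))).trace =
        (1 - ε) * (E * σ).trace + (ε / d) * E.trace := by
    simp [Matrix.mul_add, Matrix.trace_add, Matrix.trace_smul]
  have hEst : εEst = ε := by
    rw [hεEst, hρ₀, trace_noisy, div_eq_iff (sub_ne_zero.mpr hE)]
    ring
  have hε : (1 : ℂ) - ε ≠ 0 := by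
    exact_mod_cast (sub_pos.mpr hε1).ne'
  rw [hEst, hρ, trace_noisy, add_sub_cancel_right, ← mul_assoc, one_div_mul_cancel hε, one_mul]
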